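/- arXiv:1909.05292 — 2 statements merged into one kernel-verified Lean document; each statement's English description precedes it below -/
import Mathlib

section
/- Let E be the sapphire group determined by integers r, s, t, u with ru − st = 1 and rstu ≠ 0. Then there exists an automorphism ω of E with ω(d) = d^{ru+st} b^{−2su}, ω(b) = d^{−2rt} b^{ru+st}, ω(v) = d^{4rst} b^{2s−4rsu} v, and ω(a) = d^{ru+st−r} b^{s−2su} v² a. In particular, there exists an automorphism φ of E with φ(a) ∈ ⟨d, b⟩·v²·a. -/
open Matrix SemidirectProduct Multiplicative

abbrev GL2Z := GL (Fin 2) ℤ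

/-- The defining relations of the sapphire group determined by `r, s, t, u`, on the four
generators `d = 0`, `b = 1`, `v = 2`, `a = 3`. -/
def sapphireRels (r s t u : ℤ) : Set (FreeGroup (Fin 4)) :=
  { FreeGroup.of 0 * FreeGroup.of 1 * (FreeGroup.of 0)⁻¹ * (FreeGroup.of 1)⁻¹,
    FreeGroup.of 2 * FreeGroup.of 0 * (FreeGroup.of 2)⁻¹ *
      (FreeGroup.of 0 ^ (r * u + s * t) * FreeGroup.of 1 ^ (-(2 * s * u)))⁻¹,
    FreeGroup.of 2 * FreeGroup.of 1 * (FreeGroup.of 2)⁻¹ *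
      (FreeGroup.of 0 ^ (-(2 * r * t)) * FreeGroup.of 1 ^ (r * u + s * t))⁻¹,
    FreeGroup.of 3 ^ 2 * (FreeGroup.of 0)⁻¹,
    FreeGroup.of 3 * FreeGroup.of 1 * (FreeGroup.of 3)⁻¹ * FreeGroup.of 1,
    FreeGroup.of 3 * FreeGroup.of 2 * (FreeGroup.of 3)⁻¹ *
      (FreeGroup.of 0 ^ (r - r * u - s * t) * FreeGroup.of 1 ^ (s - 2 * s * u) *
        (FreeGroup.of 2)⁻¹)⁻¹ }

/-- The sapphire group: the fundamental group of the sapphire Sol 3-manifold determined by the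
matrix `[[r, s], [t, u]]`. -/
abbrev Sapphire (r s t u : ℤ) : Type := PresentedGroup (sapphireRels r s t u)

/-- The generator `d` of the sapphire group. -/
def sapd (r s t u : ℤ) : Sapphire r s t u := PresentedGroup.of 0

/-- The generator `b` of the sapphire group. -/
def sapb (r s t u : ℤ) : Sapphire r s t u := PresentedGroup.of 1

/-- The generator `v` of the sapphire group. -/
def sapv (r s t u : ℤ) : Sapphire r s t u := PresentedGroup.of 2

/-- The generator `a` of the sapphire group. -/
def sapa (r s t u : ℤ) : Sapphire r s t u := PresentedGroup.of 3

/-- The subgroup `⟨d, b⟩` of the sapphire group. -/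
def sapDB (r s t u : ℤ) : Subgroup (Sapphire r s t u) :=
  Subgroup.closure {sapd r s t u, sapb r s t u}

section Relations

variable (r s t u : ℤ)

theorem sapphire_rel_eq_one {x : FreeGroup (Fin 4)} (hx : x ∈ sapphireRels r s t u) :
    PresentedGroup.mk (sapphireRels r s t u) x = 1 :=
  PresentedGroup.one_of_mem hx

theorem sapphire_commute_d_b : Commute (sapd r s t u) (sapb r s t u) := by
  have h := sapphire_rel_eq_one r s t u (x := FreeGroup.of 0 * FreeGroup.of 1 *
    (FreeGroup.of 0)⁻¹ * (FreeGroup.of 1)⁻¹) (by simp [sapphireRels])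
  simp only [map_mul, map_inv] at h
  exact mul_inv_eq_iff_eq_mul.mp (mul_inv_eq_one.mp h)

theorem sapphire_v_conj_d : sapv r s t u * sapd r s t u * (sapv r s t u)⁻¹ =
    sapd r s t u ^ (r * u + s * t) * sapb r s t u ^ (-(2 * s * u)) := by
  have h := sapphire_rel_eq_one r s t u (x := FreeGroup.of 2 * FreeGroup.of 0 *
    (FreeGroup.of 2)⁻¹ * (FreeGroup.of 0 ^ (r * u + s * t) *
      FreeGroup.of 1 ^ (-(2 * s * u)))⁻¹) (by simp [sapphireRels])
  simp only [map_mul, map_inv, map_zpow] at h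
  exact mul_inv_eq_one.mp h

theorem sapphire_v_conj_b : sapv r s t u * sapb r s t u * (sapv r s t u)⁻¹ =
    sapd r s t u ^ (-(2 * r * t)) * sapb r s t u ^ (r * u + s * t) := by
  have h := sapphire_rel_eq_one r s t u (x := FreeGroup.of 2 * FreeGroup.of 1 *
    (FreeGroup.of 2)⁻¹ * (FreeGroup.of 0 ^ (-(2 * r * t)) *
      FreeGroup.of 1 ^ (r * u + s * t))⁻¹) (by simp [sapphireRels])
  simp only [map_mul, map_inv, map_zpow] at h
  exact mul_inv_eq_one.mp h

theorem sapphire_a_sq : sapa r s t u ^ 2 = sapd r s t u := by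
  have h := sapphire_rel_eq_one r s t u (x := FreeGroup.of 3 ^ 2 * (FreeGroup.of 0)⁻¹)
    (by simp [sapphireRels])
  simp only [map_mul, map_inv, map_pow] at h
  exact mul_inv_eq_one.mp h

theorem sapphire_a_conj_b :
    sapa r s t u * sapb r s t u * (sapa r s t u)⁻¹ = (sapb r s t u)⁻¹ := by
  have h := sapphire_rel_eq_one r s t u (x := FreeGroup.of 3 * FreeGroup.of 1 *
    (FreeGroup.of 3)⁻¹ * FreeGroup.of 1) (by simp [sapphireRels])
  simp only [map_mul, map_inv] at h
  exact mul_eq_one_iff_eq_inv.mp h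

theorem sapphire_a_conj_v : sapa r s t u * sapv r s t u * (sapa r s t u)⁻¹ =
    sapd r s t u ^ (r - r * u - s * t) * sapb r s t u ^ (s - 2 * s * u) *
      (sapv r s t u)⁻¹ := by
  have h := sapphire_rel_eq_one r s t u (x := FreeGroup.of 3 * FreeGroup.of 2 *
    (FreeGroup.of 3)⁻¹ * (FreeGroup.of 0 ^ (r - r * u - s * t) *
      FreeGroup.of 1 ^ (s - 2 * s * u) * (FreeGroup.of 2)⁻¹)⁻¹) (by simp [sapphireRels])
  simp only [map_mul, map_inv, map_zpow] at h
  exact mul_inv_eq_one.mp h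

theorem sapphire_d_b_mul (i j k l : ℤ) :
    sapd r s t u ^ i * sapb r s t u ^ j * (sapd r s t u ^ k * sapb r s t u ^ l) =
      sapd r s t u ^ (i + k) * sapb r s t u ^ (j + l) := by
  have h := ((sapphire_commute_d_b r s t u).zpow_zpow k j).eq
  rw [_root_.zpow_add, _root_.zpow_add, mul_assoc, ← mul_assoc (sapb r s t u ^ j), ← h]
  simp only [mul_assoc]

theorem sapphire_v_conj_d_b (i j : ℤ) :
    sapv r s t u * (sapd r s t u ^ i * sapb r s t u ^ j) * (sapv r s t u)⁻¹ =
      sapd r s t u ^ ((r * u + s * t) * i - 2 * r * t * j) *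
        sapb r s t u ^ ((r * u + s * t) * j - 2 * s * u * i) := by
  have hc := sapphire_commute_d_b r s t u
  rw [← conj_mul, ← conj_zpow, ← conj_zpow, sapphire_v_conj_d, sapphire_v_conj_b,
    (hc.zpow_zpow _ _).mul_zpow, (hc.zpow_zpow _ _).mul_zpow]
  simp only [← _root_.zpow_mul]
  rw [sapphire_d_b_mul]
  congr 2 <;> ring

theorem sapphire_a_mul_b_zpow (k : ℤ) :
    sapa r s t u * sapb r s t u ^ k = sapb r s t u ^ (-k) * sapa r s t u := by
  rw [← mul_inv_eq_iff_eq_mul, ← conj_zpow, sapphire_a_conj_b, _root_.inv_zpow']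

/-- The endomorphism of the sapphire group fixing `d` and `b` and left-multiplying both `v`
and `a` by `b ^ k`. -/
def sapphireTwist (k : ℤ) : Sapphire r s t u →* Sapphire r s t u :=
  PresentedGroup.toGroup (rels := sapphireRels r s t u)
    (f := ![sapd r s t u, sapb r s t u, sapb r s t u ^ k * sapv r s t u,
      sapb r s t u ^ k * sapa r s t u]) (by
    have hc := sapphire_commute_d_b r s t u
    have hb (i j : ℤ) : sapb r s t u ^ k * (sapd r s t u ^ i * sapb r s t u ^ j) *
        (sapb r s t u ^ k)⁻¹ = sapd r s t u ^ i * sapb r s t u ^ j :=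
      mul_inv_eq_of_eq_mul (((hc.symm.zpow_zpow k i).mul_right
        ((Commute.refl (sapb r s t u)).zpow_zpow k j)).eq)
    have hv (x : Sapphire r s t u) : sapb r s t u ^ k * sapv r s t u * x *
        (sapb r s t u ^ k * sapv r s t u)⁻¹ =
        sapb r s t u ^ k * (sapv r s t u * x * (sapv r s t u)⁻¹) * (sapb r s t u ^ k)⁻¹ := by
      group
    have ha := sapphire_a_mul_b_zpow r s t u k
    intro x hx
    simp only [sapphireRels, Set.mem_insert_iff, Set.mem_singleton_iff] at hx
    rcases hx with rfl | rfl | rfl | rfl | rfl | rfl <;>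
      simp only [map_mul, map_inv, map_zpow, map_pow, FreeGroup.lift_apply_of,
        Matrix.cons_val]
    · rw [hc.eq]; group
    · rw [hv, sapphire_v_conj_d, hb, mul_inv_cancel]
    · rw [hv, sapphire_v_conj_b, hb, mul_inv_cancel]
    · calc _ = sapb r s t u ^ k * (sapa r s t u * sapb r s t u ^ k) * sapa r s t u *
            (sapd r s t u)⁻¹ := by simp only [pow_two, mul_assoc]
        _ = sapa r s t u ^ 2 * (sapd r s t u)⁻¹ := by rw [ha, pow_two]; group
        _ = 1 := by rw [sapphire_a_sq, mul_inv_cancel]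
    · calc _ = sapb r s t u ^ k * (sapa r s t u * sapb r s t u * (sapa r s t u)⁻¹) *
            (sapb r s t u ^ k)⁻¹ * sapb r s t u := by group
        _ = 1 := by rw [sapphire_a_conj_b]; group
    · calc _ = sapb r s t u ^ k * (sapa r s t u * sapb r s t u ^ k) * sapv r s t u *
            (sapa r s t u)⁻¹ * (sapb r s t u ^ k)⁻¹ * (sapd r s t u ^ (r - r * u - s * t) *
              sapb r s t u ^ (s - 2 * s * u) * (sapb r s t u ^ k * sapv r s t u)⁻¹)⁻¹ := by
              simp only [mul_assoc, _root_.mul_inv_rev]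
        _ = (sapa r s t u * sapv r s t u * (sapa r s t u)⁻¹) * (sapb r s t u ^ k)⁻¹ *
            (sapd r s t u ^ (r - r * u - s * t) *
              sapb r s t u ^ (s - 2 * s * u) * (sapb r s t u ^ k * sapv r s t u)⁻¹)⁻¹ := by
              rw [ha]; group
        _ = 1 := by rw [sapphire_a_conj_v]; group)

theorem sapphireTwist_d (k : ℤ) : sapphireTwist r s t u k (sapd r s t u) = sapd r s t u :=
  PresentedGroup.toGroup.of _

theorem sapphireTwist_b (k : ℤ) : sapphireTwist r s t u k (sapb r s t u) = sapb r s t u :=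
  PresentedGroup.toGroup.of _

theorem sapphireTwist_v (k : ℤ) :
    sapphireTwist r s t u k (sapv r s t u) = sapb r s t u ^ k * sapv r s t u :=
  PresentedGroup.toGroup.of _

theorem sapphireTwist_a (k : ℤ) :
    sapphireTwist r s t u k (sapa r s t u) = sapb r s t u ^ k * sapa r s t u :=
  PresentedGroup.toGroup.of _

theorem sapphireTwist_comp_neg (k : ℤ) :
    (sapphireTwist r s t u k).comp (sapphireTwist r s t u (-k)) = MonoidHom.id _ := by
  refine PresentedGroup.ext fun i => ?_
  fin_cases i
  · change sapphireTwist r s t u k (sapphireTwist r s t u (-k) (sapd r s t u)) = sapd r s t u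
    simp only [sapphireTwist_d]
  · change sapphireTwist r s t u k (sapphireTwist r s t u (-k) (sapb r s t u)) = sapb r s t u
    simp only [sapphireTwist_b]
  · change sapphireTwist r s t u k (sapphireTwist r s t u (-k) (sapv r s t u)) = sapv r s t u
    simp only [sapphireTwist_v, map_mul, map_zpow, sapphireTwist_b]
    group
  · change sapphireTwist r s t u k (sapphireTwist r s t u (-k) (sapa r s t u)) = sapa r s t u
    simp only [sapphireTwist_a, map_mul, map_zpow, sapphireTwist_b]
    group

/-- `sapphireTwist` as an automorphism. -/
def sapphireTwistAut (k : ℤ) : MulAut (Sapphire r s t u) :=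
  MonoidHom.toMulEquiv (sapphireTwist r s t u k) (sapphireTwist r s t u (-k))
    (by simpa using sapphireTwist_comp_neg r s t u (-k)) (sapphireTwist_comp_neg r s t u k)

theorem sapphireTwistAut_apply (k : ℤ) (x : Sapphire r s t u) :
    sapphireTwistAut r s t u k x = sapphireTwist r s t u k x := rfl

theorem sapphire_v_conj_b_zpow (h1 : r * u - s * t = 1) :
    sapv r s t u * sapb r s t u ^ (-(2 * s)) * (sapv r s t u)⁻¹ =
      sapd r s t u ^ (4 * r * s * t) * sapb r s t u ^ (2 * s - 4 * r * s * u) := by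
  have h := sapphire_v_conj_d_b r s t u 0 (-(2 * s))
  rw [zpow_zero, one_mul] at h
  rw [h]
  congr 2 <;> grind

theorem sapphire_a_mul_v_inv : sapa r s t u * (sapv r s t u)⁻¹ =
    sapv r s t u * (sapd r s t u ^ (-(r - r * u - s * t)) *
      sapb r s t u ^ (-(s - 2 * s * u))) * sapa r s t u := by
  have h := congrArg (·⁻¹) (sapphire_a_conj_v r s t u)
  have hc := ((sapphire_commute_d_b r s t u).zpow_zpow (-(r - r * u - s * t))
    (-(s - 2 * s * u))).eq
  rw [← mul_inv_eq_iff_eq_mul, hc]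
  simpa only [_root_.mul_inv_rev, inv_inv, _root_.zpow_neg, mul_assoc] using h

theorem sapphire_v_conj_b_zpow_mul_a (h1 : r * u - s * t = 1) :
    sapv r s t u * (sapb r s t u ^ (-(2 * s)) * sapa r s t u) * (sapv r s t u)⁻¹ =
      sapd r s t u ^ (r * u + s * t - r) * sapb r s t u ^ (s - 2 * s * u) *
        sapv r s t u ^ 2 * sapa r s t u := by
  have key (w : Sapphire r s t u) : sapv r s t u * sapb r s t u ^ (-(2 * s)) *
      (sapv r s t u * w * sapa r s t u) =
      (sapv r s t u * sapb r s t u ^ (-(2 * s)) * (sapv r s t u)⁻¹) *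
      (sapv r s t u * (sapv r s t u * w * (sapv r s t u)⁻¹) * (sapv r s t u)⁻¹) *
      sapv r s t u ^ 2 * sapa r s t u := by
    group
  rw [← mul_assoc, mul_assoc, sapphire_a_mul_v_inv, key, sapphire_v_conj_b_zpow r s t u h1,
    sapphire_v_conj_d_b, sapphire_v_conj_d_b, sapphire_d_b_mul]
  congr 4 <;> grind

end Relations

/-- The sapphire group admits an automorphism `ω` with
`ω(d) = d^{ru+st} b^{-2su}`, `ω(b) = d^{-2rt} b^{ru+st}`, `ω(v) = d^{4rst} b^{2s-4rsu} v` and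
`ω(a) = d^{ru+st-r} b^{s-2su} v² a`; in particular some automorphism `φ` satisfies
`φ(a) ∈ ⟨d, b⟩ · v² · a`. -/
theorem stmt13 (r s t u : ℤ) (h1 : r * u - s * t = 1) (h0 : r * s * t * u ≠ 0) :
    (∃ ω : MulAut (Sapphire r s t u),
      ω (sapd r s t u) = sapd r s t u ^ (r * u + s * t) * sapb r s t u ^ (-(2 * s * u)) ∧
      ω (sapb r s t u) = sapd r s t u ^ (-(2 * r * t)) * sapb r s t u ^ (r * u + s * t) ∧
      ω (sapv r s t u) = sapd r s t u ^ (4 * r * s * t) *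
        sapb r s t u ^ (2 * s - 4 * r * s * u) * sapv r s t u ∧
      ω (sapa r s t u) = sapd r s t u ^ (r * u + s * t - r) *
        sapb r s t u ^ (s - 2 * s * u) * sapv r s t u ^ 2 * sapa r s t u) ∧
    ∃ φ : MulAut (Sapphire r s t u), ∃ g ∈ sapDB r s t u,
      φ (sapa r s t u) = g * sapv r s t u ^ 2 * sapa r s t u := by
  obtain ⟨ω, hd, hb, hv, ha⟩ : ∃ ω : MulAut (Sapphire r s t u),
      ω (sapd r s t u) = sapd r s t u ^ (r * u + s * t) * sapb r s t u ^ (-(2 * s * u)) ∧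
      ω (sapb r s t u) = sapd r s t u ^ (-(2 * r * t)) * sapb r s t u ^ (r * u + s * t) ∧
      ω (sapv r s t u) = sapd r s t u ^ (4 * r * s * t) *
        sapb r s t u ^ (2 * s - 4 * r * s * u) * sapv r s t u ∧
      ω (sapa r s t u) = sapd r s t u ^ (r * u + s * t - r) *
        sapb r s t u ^ (s - 2 * s * u) * sapv r s t u ^ 2 * sapa r s t u := by
    refine ⟨MulAut.conj (sapv r s t u) * sapphireTwistAut r s t u (-(2 * s)), ?_, ?_, ?_, ?_⟩ <;>
      rw [MulAut.mul_apply, MulAut.conj_apply, sapphireTwistAut_apply]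
    · rw [sapphireTwist_d, sapphire_v_conj_d]
    · rw [sapphireTwist_b, sapphire_v_conj_b]
    · rw [sapphireTwist_v, ← sapphire_v_conj_b_zpow r s t u h1]
      group
    · rw [sapphireTwist_a, sapphire_v_conj_b_zpow_mul_a r s t u h1]
  have hd_mem : sapd r s t u ∈ sapDB r s t u := Subgroup.subset_closure (by simp)
  have hb_mem : sapb r s t u ∈ sapDB r s t u := Subgroup.subset_closure (by simp)
  exact ⟨⟨ω, hd, hb, hv, ha⟩, ω, _,
    mul_mem (zpow_mem hd_mem _) (zpow_mem hb_mem _), ha⟩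
end

section
/- Let E be the sapphire group determined by integers r, s, t, u with ru − st = 1 and rstu ≠ 0, and let Aut₀(E) be the subgroup of Aut(E) consisting of those automorphisms φ such that φ maps the subgroup ⟨d, b⟩ onto itself and φ(v) ∈ ⟨d, b⟩·v. Then there is a split short exact sequence 1 → Aut₀⁰(E) → Aut₀(E) → ℤ → 1, where Aut₀⁰(E) is the subgroup of those φ ∈ Aut₀(E) with φ(a) ∈ ⟨d, b⟩·a; consequently Aut₀(E) is isomorphic to an iterated semidirect product ((ℤ × ℤ) ⋊ ℤ/2) ⋊ ℤ, where the nontrivial element of ℤ/2 acts on ℤ × ℤ by multiplication by −1. -/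
open Matrix SemidirectProduct Multiplicative

lemma mem_of_map_eq {G : Type*} [Group G] {K : Subgroup G} {φ : MulAut G}
    (h : K.map φ.toMonoidHom = K) {g : G} (hg : g ∈ K) : φ g ∈ K := by
  rw [← h]; exact ⟨g, hg, rfl⟩

lemma map_inv_eq_of_map_eq {G : Type*} [Group G] {K : Subgroup G} {φ : MulAut G}
    (h : K.map φ.toMonoidHom = K) : K.map (φ⁻¹ : MulAut G).toMonoidHom = K := by
  conv_lhs => rw [← h]
  rw [Subgroup.map_map]
  have hid : ((φ⁻¹ : MulAut G).toMonoidHom.comp φ.toMonoidHom) = MonoidHom.id G := by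
    refine MonoidHom.ext fun x => ?_
    show (φ⁻¹ : MulAut G) (φ x) = x
    simp
  rw [hid, Subgroup.map_id]

/-- The subgroup `Aut₀(E)` of automorphisms of the sapphire group mapping `⟨d, b⟩` onto itself
and with `φ(v) ∈ ⟨d, b⟩ · v`. -/
def sapAut₀ (r s t u : ℤ) : Subgroup (MulAut (Sapphire r s t u)) where
  carrier := {φ | (sapDB r s t u).map φ.toMonoidHom = sapDB r s t u ∧
    ∃ g ∈ sapDB r s t u, φ (sapv r s t u) = g * sapv r s t u}
  one_mem' := by
    refine ⟨?_, 1, one_mem _, by simp⟩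
    have : ((1 : MulAut (Sapphire r s t u)).toMonoidHom) = MonoidHom.id _ := rfl
    rw [this, Subgroup.map_id]
  mul_mem' := by
    intro x y hx hy
    obtain ⟨hx1, gx, hgx, hgxv⟩ := hx
    obtain ⟨hy1, gy, hgy, hgyv⟩ := hy
    have hmap : ((x * y : MulAut (Sapphire r s t u)).toMonoidHom)
        = x.toMonoidHom.comp y.toMonoidHom := rfl
    refine ⟨by rw [hmap, ← Subgroup.map_map, hy1, hx1], x gy * gx, ?_, ?_⟩
    · exact mul_mem (mem_of_map_eq hx1 hgy) hgx
    · have : (x * y : MulAut (Sapphire r s t u)) (sapv r s t u) = x (y (sapv r s t u)) := rfl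
      rw [this, hgyv, _root_.map_mul, hgxv, ← mul_assoc]
  inv_mem' := by
    intro x hx
    obtain ⟨hx1, g, hg, hgv⟩ := hx
    refine ⟨map_inv_eq_of_map_eq hx1, ((x⁻¹ : MulAut (Sapphire r s t u)) g)⁻¹,
      inv_mem (mem_of_map_eq (map_inv_eq_of_map_eq hx1) hg), ?_⟩
    have h1 : (x⁻¹ : MulAut (Sapphire r s t u)) (x (sapv r s t u)) = sapv r s t u := by simp
    rw [hgv, _root_.map_mul] at h1
    rw [eq_inv_mul_iff_mul_eq, h1]

/-- The subgroup `Aut₀⁰(E)` of automorphisms of the sapphire group mapping `⟨d, b⟩` onto itself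
and with `φ(v) ∈ ⟨d, b⟩ · v` and `φ(a) ∈ ⟨d, b⟩ · a`. -/
def sapAut₀₀ (r s t u : ℤ) : Subgroup (MulAut (Sapphire r s t u)) where
  carrier := {φ | (sapDB r s t u).map φ.toMonoidHom = sapDB r s t u ∧
    (∃ g ∈ sapDB r s t u, φ (sapv r s t u) = g * sapv r s t u) ∧
    (∃ g ∈ sapDB r s t u, φ (sapa r s t u) = g * sapa r s t u)}
  one_mem' := by
    refine ⟨?_, ⟨1, one_mem _, by simp⟩, ⟨1, one_mem _, by simp⟩⟩
    have : ((1 : MulAut (Sapphire r s t u)).toMonoidHom) = MonoidHom.id _ := rfl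
    rw [this, Subgroup.map_id]
  mul_mem' := by
    intro x y hx hy
    obtain ⟨hx1, ⟨gx, hgx, hgxv⟩, ⟨kx, hkx, hkxa⟩⟩ := hx
    obtain ⟨hy1, ⟨gy, hgy, hgyv⟩, ⟨ky, hky, hkya⟩⟩ := hy
    have hmap : ((x * y : MulAut (Sapphire r s t u)).toMonoidHom)
        = x.toMonoidHom.comp y.toMonoidHom := rfl
    refine ⟨by rw [hmap, ← Subgroup.map_map, hy1, hx1],
      ⟨x gy * gx, mul_mem (mem_of_map_eq hx1 hgy) hgx, ?_⟩,
      ⟨x ky * kx, mul_mem (mem_of_map_eq hx1 hky) hkx, ?_⟩⟩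
    · have : (x * y : MulAut (Sapphire r s t u)) (sapv r s t u) = x (y (sapv r s t u)) := rfl
      rw [this, hgyv, _root_.map_mul, hgxv, ← mul_assoc]
    · have : (x * y : MulAut (Sapphire r s t u)) (sapa r s t u) = x (y (sapa r s t u)) := rfl
      rw [this, hkya, _root_.map_mul, hkxa, ← mul_assoc]
  inv_mem' := by
    intro x hx
    obtain ⟨hx1, ⟨g, hg, hgv⟩, ⟨k, hk, hka⟩⟩ := hx
    refine ⟨map_inv_eq_of_map_eq hx1,
      ⟨((x⁻¹ : MulAut (Sapphire r s t u)) g)⁻¹,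
        inv_mem (mem_of_map_eq (map_inv_eq_of_map_eq hx1) hg), ?_⟩,
      ⟨((x⁻¹ : MulAut (Sapphire r s t u)) k)⁻¹,
        inv_mem (mem_of_map_eq (map_inv_eq_of_map_eq hx1) hk), ?_⟩⟩
    · have h1 : (x⁻¹ : MulAut (Sapphire r s t u)) (x (sapv r s t u)) = sapv r s t u := by simp
      rw [hgv, _root_.map_mul] at h1
      rw [eq_inv_mul_iff_mul_eq, h1]
    · have h1 : (x⁻¹ : MulAut (Sapphire r s t u)) (x (sapa r s t u)) = sapa r s t u := by simp
      rw [hka, _root_.map_mul] at h1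
      rw [eq_inv_mul_iff_mul_eq, h1]

section Sapphire

variable {r s t u : ℤ}

local notation "𝐝" => sapd r s t u
local notation "𝐛" => sapb r s t u
local notation "𝐯" => sapv r s t u
local notation "𝐚" => sapa r s t u

/-- The element `d ^ x * b ^ y` of the sapphire group. -/
def sapTau (r s t u x y : ℤ) : Sapphire r s t u := sapd r s t u ^ x * sapb r s t u ^ y

local notation "τ" => sapTau r s t u

lemma sapd_comm_sapb : Commute 𝐝 𝐛 := by
  have h : 𝐝 * 𝐛 * 𝐝⁻¹ * 𝐛⁻¹ = 1 :=
    PresentedGroup.one_of_mem (rels := sapphireRels r s t u) (by simp [sapphireRels])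
  rwa [mul_inv_eq_one, mul_inv_eq_iff_eq_mul] at h

lemma sapTau_mul (x y x' y' : ℤ) : τ x y * τ x' y' = τ (x + x') (y + y') := by
  have h := (sapd_comm_sapb (r := r) (s := s) (t := t) (u := u)).zpow_zpow x' y
  simp only [sapTau, _root_.zpow_add]
  calc _ = 𝐝 ^ x * (𝐛 ^ y * 𝐝 ^ x') * 𝐛 ^ y' := by group
    _ = _ := by rw [← h.eq]; group

lemma sapTau_zero : τ 0 0 = 1 := by simp [sapTau]

lemma sapTau_inv (x y : ℤ) : (τ x y)⁻¹ = τ (-x) (-y) := by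
  rw [inv_eq_iff_mul_eq_one, sapTau_mul, add_neg_cancel, add_neg_cancel, sapTau_zero]

lemma sapTau_zpow (x y n : ℤ) : τ x y ^ n = τ (x * n) (y * n) := by
  rw [sapTau, ((sapd_comm_sapb (r := r) (s := s) (t := t) (u := u)).zpow_zpow x y).mul_zpow,
    ← _root_.zpow_mul, ← _root_.zpow_mul, sapTau]

lemma sapd_eq : 𝐝 = τ 1 0 := by simp [sapTau]

lemma sapb_eq : 𝐛 = τ 0 1 := by simp [sapTau]

lemma sapv_mul_sapTau (x y : ℤ) : 𝐯 * τ x y =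
    τ ((r * u + s * t) * x - 2 * r * t * y) (-2 * s * u * x + (r * u + s * t) * y) * 𝐯 := by
  have hd : 𝐯 * 𝐝 * 𝐯⁻¹ * (τ (r * u + s * t) (-(2 * s * u)))⁻¹ = 1 :=
    PresentedGroup.one_of_mem (rels := sapphireRels r s t u) (by simp [sapphireRels])
  have hb : 𝐯 * 𝐛 * 𝐯⁻¹ * (τ (-(2 * r * t)) (r * u + s * t))⁻¹ = 1 :=
    PresentedGroup.one_of_mem (rels := sapphireRels r s t u) (by simp [sapphireRels])
  rw [mul_inv_eq_one] at hd hb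
  rw [← mul_inv_eq_iff_eq_mul, sapTau]
  calc _ = (𝐯 * 𝐝 * 𝐯⁻¹) ^ x * (𝐯 * 𝐛 * 𝐯⁻¹) ^ y := by simp only [conj_zpow]; group
    _ = _ := by
      rw [hd, hb, sapTau_zpow, sapTau_zpow, sapTau_mul]
      congr 1 <;> ring

lemma sapv_inv_mul_sapTau (h1 : r * u - s * t = 1) (x y : ℤ) : 𝐯⁻¹ * τ x y =
    τ ((r * u + s * t) * x + 2 * r * t * y) (2 * s * u * x + (r * u + s * t) * y) * 𝐯⁻¹ := by
  rw [inv_mul_eq_iff_eq_mul, ← mul_assoc, sapv_mul_sapTau, mul_inv_cancel_right]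
  congr 1
  · linear_combination (-x * (r * u - s * t + 1)) * h1
  · linear_combination (-y * (r * u - s * t + 1)) * h1

lemma sapa_sq : 𝐚 * 𝐚 = τ 1 0 := by
  have h : 𝐚 ^ 2 * 𝐝⁻¹ = 1 :=
    PresentedGroup.one_of_mem (rels := sapphireRels r s t u) (by simp [sapphireRels])
  rwa [mul_inv_eq_one, sq, sapd_eq] at h

lemma sapa_mul_sapTau (x y : ℤ) : 𝐚 * τ x y = τ x (-y) * 𝐚 := by
  have hb : 𝐚 * 𝐛 * 𝐚⁻¹ * 𝐛 = 1 :=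
    PresentedGroup.one_of_mem (rels := sapphireRels r s t u) (by simp [sapphireRels])
  have hd : 𝐚 * 𝐝 * 𝐚⁻¹ = 𝐝 := by
    rw [sapd_eq, ← sapa_sq]; group
  rw [mul_eq_one_iff_eq_inv] at hb
  rw [← mul_inv_eq_iff_eq_mul, sapTau, sapTau]
  calc _ = (𝐚 * 𝐝 * 𝐚⁻¹) ^ x * (𝐚 * 𝐛 * 𝐚⁻¹) ^ y := by simp only [conj_zpow]; group
    _ = _ := by rw [hd, hb, _root_.inv_zpow, _root_.zpow_neg]

lemma sapa_mul_sapv : 𝐚 * 𝐯 =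
    τ (r - r * u - s * t) (s - 2 * s * u) * 𝐯⁻¹ * 𝐚 := by
  have h : 𝐚 * 𝐯 * 𝐚⁻¹ * (τ (r - r * u - s * t) (s - 2 * s * u) * 𝐯⁻¹)⁻¹ = 1 :=
    PresentedGroup.one_of_mem (rels := sapphireRels r s t u) (by simp [sapphireRels])
  rwa [mul_inv_eq_one, mul_inv_eq_iff_eq_mul] at h

lemma mem_sapDB_iff {x : Sapphire r s t u} : x ∈ sapDB r s t u ↔ ∃ i j, x = τ i j := by
  constructor
  · intro hx
    induction hx using Subgroup.closure_induction with
    | mem x hx =>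
      rcases hx with rfl | rfl
      · exact ⟨1, 0, sapd_eq⟩
      · exact ⟨0, 1, sapb_eq⟩
    | one => exact ⟨0, 0, sapTau_zero.symm⟩
    | mul x y _ _ hx hy =>
      obtain ⟨i, j, rfl⟩ := hx
      obtain ⟨k, l, rfl⟩ := hy
      exact ⟨_, _, sapTau_mul ..⟩
    | inv x _ hx =>
      obtain ⟨i, j, rfl⟩ := hx
      exact ⟨_, _, sapTau_inv ..⟩
  · rintro ⟨i, j, rfl⟩
    exact mul_mem (zpow_mem (Subgroup.subset_closure (by simp)) _)
      (zpow_mem (Subgroup.subset_closure (by simp)) _)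

lemma sapTau_mem (x y : ℤ) : τ x y ∈ sapDB r s t u := mem_sapDB_iff.2 ⟨x, y, rfl⟩

/-- Extension of an assignment on the generators to a homomorphism on the sapphire group. -/
def sapLift {G : Type*} [Group G] (d b v a : G) (hdb : d * b = b * d)
    (hvd : v * d = d ^ (r * u + s * t) * b ^ (-(2 * s * u)) * v)
    (hvb : v * b = d ^ (-(2 * r * t)) * b ^ (r * u + s * t) * v)
    (ha : a * a = d) (hab : a * b = b⁻¹ * a)
    (hav : a * v = d ^ (r - r * u - s * t) * b ^ (s - 2 * s * u) * v⁻¹ * a) :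
    Sapphire r s t u →* G :=
  PresentedGroup.toGroup (f := ![d, b, v, a]) (by
    intro x hx
    simp only [sapphireRels, Set.mem_insert_iff, Set.mem_singleton_iff] at hx
    rcases hx with rfl | rfl | rfl | rfl | rfl | rfl
    · simp [hdb]
    · simp [hvd]
    · simp [hvb]
    · simp [sq, ha]
    · simp [hab]
    · simp [hav])

lemma sapLift_sapd {G : Type*} [Group G] {d b v a : G} (hdb hvd hvb ha hab hav) :
    sapLift (r := r) (s := s) (t := t) (u := u) d b v a hdb hvd hvb ha hab hav 𝐝 = d :=
  PresentedGroup.toGroup.of _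

lemma sapLift_sapb {G : Type*} [Group G] {d b v a : G} (hdb hvd hvb ha hab hav) :
    sapLift (r := r) (s := s) (t := t) (u := u) d b v a hdb hvd hvb ha hab hav 𝐛 = b :=
  PresentedGroup.toGroup.of _

lemma sapLift_sapv {G : Type*} [Group G] {d b v a : G} (hdb hvd hvb ha hab hav) :
    sapLift (r := r) (s := s) (t := t) (u := u) d b v a hdb hvd hvb ha hab hav 𝐯 = v :=
  PresentedGroup.toGroup.of _

lemma sapLift_sapa {G : Type*} [Group G] {d b v a : G} (hdb hvd hvb ha hab hav) :
    sapLift (r := r) (s := s) (t := t) (u := u) d b v a hdb hvd hvb ha hab hav 𝐚 = a :=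
  PresentedGroup.toGroup.of _

lemma sapphire_hom_ext {G : Type*} [Group G] {f g : Sapphire r s t u →* G}
    (hd : f 𝐝 = g 𝐝) (hb : f 𝐛 = g 𝐛) (hv : f 𝐯 = g 𝐯) (ha : f 𝐚 = g 𝐚) : f = g := by
  refine PresentedGroup.ext fun i => ?_
  fin_cases i
  exacts [hd, hb, hv, ha]

/-- The affine permutation `x ↦ A x + c` of `ℤ × ℤ`, for `A = [[k, l], [m, n]]` of
determinant `ε` with `ε * ε = 1`. -/
def affinePerm (k l m n c₁ c₂ ε : ℤ) (h : k * n - l * m = ε) (hε : ε * ε = 1) :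
    Equiv.Perm (ℤ × ℤ) where
  toFun x := (k * x.1 + l * x.2 + c₁, m * x.1 + n * x.2 + c₂)
  invFun x := (ε * (n * (x.1 - c₁) - l * (x.2 - c₂)), ε * (-m * (x.1 - c₁) + k * (x.2 - c₂)))
  left_inv x := by
    ext
    · dsimp only; linear_combination x.1 * ε * h + x.1 * hε
    · dsimp only; linear_combination x.2 * ε * h + x.2 * hε
  right_inv x := by
    ext
    · dsimp only; linear_combination (x.1 - c₁) * ε * h + (x.1 - c₁) * hε
    · dsimp only; linear_combination (x.2 - c₂) * ε * h + (x.2 - c₂) * hε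

/-- The permutation `x ↦ x + (i, j)` of `ℤ × ℤ`. -/
def translationHom : Multiplicative (ℤ × ℤ) →* Equiv.Perm (ℤ × ℤ) where
  toFun c := Equiv.addLeft c.toAdd
  map_one' := by ext <;> simp
  map_mul' c c' := by ext <;> simp

lemma translationHom_apply (i j : ℤ) (x : ℤ × ℤ) :
    translationHom (ofAdd (i, j)) x = (i + x.1, j + x.2) := rfl

lemma translationHom_zpow_mul (i j : ℤ) :
    translationHom (ofAdd (2, 0)) ^ i * translationHom (ofAdd (0, 2)) ^ j =
      translationHom (ofAdd (i * 2, j * 2)) := by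
  rw [← map_zpow translationHom, ← map_zpow translationHom, ← _root_.map_mul,
    ← ofAdd_zsmul, ← ofAdd_zsmul, ← ofAdd_add]
  simp

lemma exists_affine_action (h1 : r * u - s * t = 1) :
    ∃ ρ : Sapphire r s t u →* Equiv.Perm (ℤ × ℤ), ∀ i j, ρ (τ i j) (0, 0) = (i * 2, j * 2) := by
  have hM : (r * u + s * t) * (r * u + s * t) - (-(2 * r * t)) * (-(2 * s * u)) = 1 := by
    linear_combination (r * u - s * t + 1) * h1
  let V := affinePerm (r * u + s * t) (-(2 * r * t)) (-(2 * s * u)) (r * u + s * t)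
    (r - 1) (-s) 1 hM rfl
  let A := affinePerm 1 0 0 (-1) 1 0 (-1) rfl rfl
  refine ⟨sapLift (translationHom (ofAdd (2, 0))) (translationHom (ofAdd (0, 2))) V A
    ?_ ?_ ?_ ?_ ?_ ?_, ?_⟩
  · rw [← _root_.map_mul, mul_comm, _root_.map_mul]
  · rw [translationHom_zpow_mul]
    ext x <;> simp [V, affinePerm, translationHom_apply] <;> ring
  · rw [translationHom_zpow_mul]
    ext x <;> simp [V, affinePerm, translationHom_apply] <;> ring
  · ext x <;> simp [A, affinePerm, translationHom_apply]
    ring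
  · rw [eq_inv_mul_iff_mul_eq]
    ext x <;> simp [A, affinePerm, translationHom_apply]
  · rw [translationHom_zpow_mul, mul_assoc, ← inv_mul_eq_iff_eq_mul, eq_inv_mul_iff_mul_eq,
      ← map_inv, ← ofAdd_neg]
    ext x <;> simp [V, A, affinePerm, translationHom_apply]
    · linear_combination ((x.1 + 2) * (r * u - s * t + 1) - r) * h1
    · linear_combination (s - x.2 * (r * u - s * t + 1)) * h1
  · intro i j
    rw [sapTau, _root_.map_mul, map_zpow, map_zpow, sapLift_sapd, sapLift_sapb,
      translationHom_zpow_mul, translationHom_apply]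
    simp

lemma sapTau_inj (h1 : r * u - s * t = 1) {i j k l : ℤ} (h : τ i j = τ k l) : i = k ∧ j = l := by
  obtain ⟨ρ, hρ⟩ := exists_affine_action h1
  have := congrArg (fun x => ρ x (0, 0)) h
  simp only [hρ, Prod.mk.injEq] at this
  omega

/-- The quotient map of the sapphire group by `⟨d, b⟩`. -/
def sapToDihedral (r s t u : ℤ) : Sapphire r s t u →* DihedralGroup 0 :=
  sapLift 1 1 (.r 1) (.sr 0) rfl (by simp) (by simp) (by simp) (by simp) (by simp)

lemma sapToDihedral_sapTau (i j : ℤ) : sapToDihedral r s t u (τ i j) = 1 := by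
  rw [sapTau, _root_.map_mul, map_zpow, map_zpow, sapToDihedral, sapLift_sapd, sapLift_sapb]
  simp

lemma sapToDihedral_sapv : sapToDihedral r s t u 𝐯 = .r 1 := sapLift_sapv ..

lemma sapToDihedral_sapa : sapToDihedral r s t u 𝐚 = .sr 0 := sapLift_sapa ..

lemma sapToDihedral_mul_zpow (i j n : ℤ) :
    sapToDihedral r s t u (τ i j * 𝐯 ^ n) = .r (Int.cast n) := by
  rw [_root_.map_mul, map_zpow, sapToDihedral_sapTau, sapToDihedral_sapv, one_mul]
  exact DihedralGroup.r_one_zpow n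

lemma sapToDihedral_mul_zpow_mul (i j n : ℤ) :
    sapToDihedral r s t u (τ i j * 𝐯 ^ n * 𝐚) = .sr (-Int.cast n) := by
  rw [_root_.map_mul, sapToDihedral_mul_zpow, sapToDihedral_sapa, DihedralGroup.r_mul_sr, zero_sub]

lemma exists_sapa_mul_sapv_inv : ∃ i j, 𝐚 * 𝐯⁻¹ = τ i j * 𝐯 * 𝐚 := by
  exact ⟨_, _, by
    rw [← sapv_mul_sapTau (-(r - r * u - s * t)) (-(s - 2 * s * u)), ← sapTau_inv,
      mul_inv_eq_iff_eq_mul, mul_assoc, sapa_mul_sapv]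
    group⟩

lemma exists_sapa_mul_zpow (h1 : r * u - s * t = 1) (n : ℤ) :
    ∃ i j, 𝐚 * 𝐯 ^ n = τ i j * 𝐯 ^ (-n) * 𝐚 := by
  induction n using Int.induction_on with
  | zero => exact ⟨0, 0, by simp [sapTau_zero]⟩
  | succ n ih =>
    obtain ⟨i, j, h⟩ := ih
    exact ⟨_, _, by
      rw [add_comm, _root_.zpow_add, zpow_one, ← mul_assoc, sapa_mul_sapv, mul_assoc, h,
        ← mul_assoc, ← mul_assoc, mul_assoc (τ _ _) _ (τ _ _), sapv_inv_mul_sapTau h1,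
        ← mul_assoc, sapTau_mul, neg_add, _root_.zpow_add, _root_.zpow_neg_one]
      rw [mul_assoc (τ _ _), mul_assoc (τ _ _)]⟩
  | pred n ih =>
    obtain ⟨i, j, h⟩ := ih
    obtain ⟨k, l, h'⟩ := exists_sapa_mul_sapv_inv (r := r) (s := s) (t := t) (u := u)
    exact ⟨_, _, by
      rw [sub_eq_neg_add, _root_.zpow_add, _root_.zpow_neg_one, ← mul_assoc, h', mul_assoc,
        h, ← mul_assoc, ← mul_assoc, mul_assoc (τ _ _) _ (τ _ _), sapv_mul_sapTau,
        ← mul_assoc, sapTau_mul, neg_add, _root_.zpow_add, neg_neg, neg_neg, zpow_one]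
      rw [mul_assoc (τ _ _), mul_assoc (τ _ _)]⟩

lemma sapphire_normal_form (h1 : r * u - s * t = 1) (x : Sapphire r s t u) :
    ∃ i j n : ℤ, x = τ i j * 𝐯 ^ n ∨ x = τ i j * 𝐯 ^ n * 𝐚 := by
  have hτ : ∀ i j y, (∃ k l n : ℤ, y = τ k l * 𝐯 ^ n ∨ y = τ k l * 𝐯 ^ n * 𝐚) →
      ∃ k l n : ℤ, τ i j * y = τ k l * 𝐯 ^ n ∨ τ i j * y = τ k l * 𝐯 ^ n * 𝐚 := by
    rintro i j _ ⟨k, l, n, rfl | rfl⟩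
    · exact ⟨_, _, n, .inl (by rw [← mul_assoc, sapTau_mul])⟩
    · exact ⟨_, _, n, .inr (by rw [← mul_assoc, ← mul_assoc, sapTau_mul])⟩
  have ha : ∀ y, (∃ k l n : ℤ, y = τ k l * 𝐯 ^ n ∨ y = τ k l * 𝐯 ^ n * 𝐚) →
      ∃ k l n : ℤ, 𝐚 * y = τ k l * 𝐯 ^ n ∨ 𝐚 * y = τ k l * 𝐯 ^ n * 𝐚 := by
    rintro _ ⟨k, l, n, hy⟩
    obtain ⟨i, j, h⟩ := exists_sapa_mul_zpow h1 n
    have h' : 𝐚 * (τ k l * 𝐯 ^ n) = τ (k + i) (-l + j) * 𝐯 ^ (-n) * 𝐚 := by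
      rw [← mul_assoc, sapa_mul_sapTau, mul_assoc, h, ← mul_assoc, ← mul_assoc, sapTau_mul]
    rcases hy with rfl | rfl
    · exact ⟨_, _, -n, .inr h'⟩
    · rw [← mul_assoc, h', mul_assoc, sapa_sq, mul_assoc]
      refine hτ _ _ _ ?_
      have hv : ∀ m : ℤ, ∃ i j, 𝐯 ^ m * τ 1 0 = τ i j * 𝐯 ^ m := by
        intro m
        induction m using Int.induction_on with
        | zero => exact ⟨1, 0, by simp⟩
        | succ m ih =>
          obtain ⟨i, j, h⟩ := ih
          exact ⟨_, _, by
            rw [add_comm, _root_.zpow_add, mul_assoc, h, zpow_one, ← mul_assoc, sapv_mul_sapTau,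
              mul_assoc]⟩
        | pred m ih =>
          obtain ⟨i, j, h⟩ := ih
          exact ⟨_, _, by
            rw [sub_eq_neg_add, _root_.zpow_add, mul_assoc, h, _root_.zpow_neg_one, ← mul_assoc,
              sapv_inv_mul_sapTau h1, mul_assoc]⟩
      obtain ⟨i, j, h⟩ := hv (-n)
      exact ⟨i, j, -n, .inl h⟩
  have hx : x ∈ Subgroup.closure (Set.range PresentedGroup.of) := by
    rw [PresentedGroup.closure_range_of]; trivial
  induction hx using Subgroup.closure_induction_left with
  | one => exact ⟨0, 0, 0, .inl (by simp [sapTau_zero])⟩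
  | mul_left x hx y _ ih =>
    obtain ⟨i, rfl⟩ := hx
    fin_cases i
    · change ∃ k l n : ℤ, 𝐝 * y = _ ∨ 𝐝 * y = _
      rw [sapd_eq]; exact hτ _ _ _ ih
    · change ∃ k l n : ℤ, 𝐛 * y = _ ∨ 𝐛 * y = _
      rw [sapb_eq]; exact hτ _ _ _ ih
    · change ∃ k l n : ℤ, 𝐯 * y = _ ∨ 𝐯 * y = _
      obtain ⟨k, l, n, rfl | rfl⟩ := ih
      · exact ⟨_, _, 1 + n, .inl (by
          rw [← mul_assoc, sapv_mul_sapTau, _root_.zpow_add, zpow_one, mul_assoc])⟩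
      · exact ⟨_, _, 1 + n, .inr (by
          rw [← mul_assoc, ← mul_assoc, sapv_mul_sapTau, _root_.zpow_add, zpow_one,
            mul_assoc (τ _ _)])⟩
    · exact ha _ ih
  | inv_mul_cancel x hx y _ ih =>
    obtain ⟨i, rfl⟩ := hx
    fin_cases i
    · change ∃ k l n : ℤ, 𝐝⁻¹ * y = _ ∨ 𝐝⁻¹ * y = _
      rw [sapd_eq, sapTau_inv]; exact hτ _ _ _ ih
    · change ∃ k l n : ℤ, 𝐛⁻¹ * y = _ ∨ 𝐛⁻¹ * y = _
      rw [sapb_eq, sapTau_inv]; exact hτ _ _ _ ih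
    · change ∃ k l n : ℤ, 𝐯⁻¹ * y = _ ∨ 𝐯⁻¹ * y = _
      obtain ⟨k, l, n, rfl | rfl⟩ := ih
      · exact ⟨_, _, -1 + n, .inl (by
          rw [← mul_assoc, sapv_inv_mul_sapTau h1, _root_.zpow_add, _root_.zpow_neg_one,
            mul_assoc])⟩
      · exact ⟨_, _, -1 + n, .inr (by
          rw [← mul_assoc, ← mul_assoc, sapv_inv_mul_sapTau h1, _root_.zpow_add,
            _root_.zpow_neg_one, mul_assoc (τ _ _)])⟩
    · change ∃ k l n : ℤ, 𝐚⁻¹ * y = _ ∨ 𝐚⁻¹ * y = _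
      have : 𝐚⁻¹ * y = τ (-1) (-0) * (𝐚 * y) := by
        rw [← sapTau_inv, ← sapa_sq]; group
      rw [this]
      exact hτ _ _ _ (ha _ ih)

lemma sapToDihedral_eq_one_iff (h1 : r * u - s * t = 1) {x : Sapphire r s t u} :
    sapToDihedral r s t u x = 1 ↔ x ∈ sapDB r s t u := by
  refine ⟨fun h => ?_, fun h => ?_⟩
  · obtain ⟨i, j, n, rfl | rfl⟩ := sapphire_normal_form h1 x
    · rw [sapToDihedral_mul_zpow, DihedralGroup.one_def] at h
      have hn : n = 0 := Int.cast_eq_zero.1 (DihedralGroup.r.inj h)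
      simpa [hn] using sapTau_mem i j
    · rw [sapToDihedral_mul_zpow_mul, DihedralGroup.one_def] at h
      cases h
  · obtain ⟨i, j, rfl⟩ := mem_sapDB_iff.1 h
    exact sapToDihedral_sapTau i j

/-- The endomorphism of the sapphire group acting on `⟨d, b⟩` by the scalar `ε` and sending `v` to
`d ^ g₁ * b ^ g₂ * v` and `a` to `d ^ k₁ * b ^ k₂ * a`. -/
def sapScalarHom (h1 : r * u - s * t = 1) (ε g₁ g₂ k₁ k₂ : ℤ) (hk : 2 * k₁ + 1 = ε)
    (h₁ : k₁ + g₁ + (r - r * u - s * t) = ε * (r - r * u - s * t) +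
      ((r * u + s * t) * (k₁ - g₁) + 2 * r * t * (k₂ - g₂)))
    (h₂ : k₂ - g₂ + (s - 2 * s * u) = ε * (s - 2 * s * u) +
      (2 * s * u * (k₁ - g₁) + (r * u + s * t) * (k₂ - g₂))) :
    Sapphire r s t u →* Sapphire r s t u :=
  sapLift (τ ε 0) (τ 0 ε) (τ g₁ g₂ * 𝐯) (τ k₁ k₂ * 𝐚)
    (by rw [sapTau_mul, sapTau_mul, add_comm ε, add_comm 0])
    (by
      rw [mul_assoc, sapv_mul_sapTau, ← mul_assoc, ← mul_assoc, sapTau_zpow, sapTau_zpow,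
        sapTau_mul, sapTau_mul, sapTau_mul]
      congr 2 <;> ring)
    (by
      rw [mul_assoc, sapv_mul_sapTau, ← mul_assoc, ← mul_assoc, sapTau_zpow, sapTau_zpow,
        sapTau_mul, sapTau_mul, sapTau_mul]
      congr 2 <;> ring)
    (by
      rw [mul_assoc, ← mul_assoc 𝐚, sapa_mul_sapTau, mul_assoc _ 𝐚, sapa_sq, sapTau_mul,
        sapTau_mul]
      congr 1 <;> linarith)
    (by
      rw [mul_assoc, sapa_mul_sapTau, ← mul_assoc, sapTau_inv, ← mul_assoc, sapTau_mul,
        sapTau_mul]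
      congr 2 <;> ring)
    (by
      have hv (x : Sapphire r s t u) (i j : ℤ) : x * 𝐯⁻¹ * τ i j =
          x * τ ((r * u + s * t) * i + 2 * r * t * j) (2 * s * u * i + (r * u + s * t) * j) *
            𝐯⁻¹ := by
        rw [mul_assoc, sapv_inv_mul_sapTau h1, ← mul_assoc]
      rw [mul_assoc, ← mul_assoc 𝐚, sapa_mul_sapTau, mul_assoc _ 𝐚, sapa_mul_sapv]
      simp only [_root_.mul_inv_rev, sapTau_inv, sapTau_zpow, ← mul_assoc, sapTau_mul, hv]
      congr 3 <;> linarith)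

lemma sapScalarHom_sapTau (h1 : r * u - s * t = 1) {ε g₁ g₂ k₁ k₂ : ℤ} (hk h₁ h₂) (i j : ℤ) :
    sapScalarHom h1 ε g₁ g₂ k₁ k₂ hk h₁ h₂ (τ i j) = τ (ε * i) (ε * j) := by
  rw [sapTau, _root_.map_mul, map_zpow, map_zpow, sapScalarHom, sapLift_sapd, sapLift_sapb,
    sapTau_zpow, sapTau_zpow, sapTau_mul]
  congr 1 <;> ring

lemma sapScalarHom_sapv (h1 : r * u - s * t = 1) {ε g₁ g₂ k₁ k₂ : ℤ} (hk h₁ h₂) :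
    sapScalarHom h1 ε g₁ g₂ k₁ k₂ hk h₁ h₂ 𝐯 = τ g₁ g₂ * 𝐯 := sapLift_sapv ..

lemma sapScalarHom_sapa (h1 : r * u - s * t = 1) {ε g₁ g₂ k₁ k₂ : ℤ} (hk h₁ h₂) :
    sapScalarHom h1 ε g₁ g₂ k₁ k₂ hk h₁ h₂ 𝐚 = τ k₁ k₂ * 𝐚 := sapLift_sapa ..

lemma sapphire_hom_ext_sapTau {G : Type*} [Group G] {f g : Sapphire r s t u →* G}
    (hτ : ∀ i j, f (τ i j) = g (τ i j)) (hv : f 𝐯 = g 𝐯) (ha : f 𝐚 = g 𝐚) : f = g :=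
  sapphire_hom_ext (by rw [sapd_eq]; exact hτ ..) (by rw [sapb_eq]; exact hτ ..) hv ha

/-- The endomorphism of the sapphire group that fixes `d` and `b` and is determined by the pair
`c = (m, y)`. -/
def sapTranslHom (h1 : r * u - s * t = 1) (c : ℤ × ℤ) : Sapphire r s t u →* Sapphire r s t u :=
  sapScalarHom h1 1 (t * c.1) (c.2 - u * c.1) 0 c.2 rfl
    (by linear_combination (-t * c.1) * h1)
    (by linear_combination (-u * c.1) * h1)

/-- The involutive endomorphism of the sapphire group that inverts `d` and `b`. -/
def sapFlipHom (h1 : r * u - s * t = 1) : Sapphire r s t u →* Sapphire r s t u :=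
  sapScalarHom h1 (-1) (1 - r) s (-1) 0 rfl
    (by linear_combination -r * h1)
    (by linear_combination -s * h1)

lemma sapTranslHom_comp (h1 : r * u - s * t = 1) (c c' : ℤ × ℤ) :
    (sapTranslHom h1 c).comp (sapTranslHom h1 c') = sapTranslHom h1 (c + c') := by
  refine sapphire_hom_ext_sapTau (fun i j => ?_) ?_ ?_
  · simp only [sapTranslHom, MonoidHom.comp_apply, sapScalarHom_sapTau, one_mul]
  · simp only [sapTranslHom, MonoidHom.comp_apply, sapScalarHom_sapTau, sapScalarHom_sapv,
      _root_.map_mul, ← mul_assoc, sapTau_mul, Prod.fst_add, Prod.snd_add]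
    congr 2 <;> ring
  · simp only [sapTranslHom, MonoidHom.comp_apply, sapScalarHom_sapTau, sapScalarHom_sapa,
      _root_.map_mul, ← mul_assoc, sapTau_mul, Prod.snd_add]
    congr 2
    ring

lemma sapTranslHom_zero (h1 : r * u - s * t = 1) : sapTranslHom h1 0 = MonoidHom.id _ := by
  refine sapphire_hom_ext_sapTau (fun i j => ?_) ?_ ?_
  · simp [sapTranslHom, sapScalarHom_sapTau]
  · simp [sapTranslHom, sapScalarHom_sapv, sapTau_zero]
  · simp [sapTranslHom, sapScalarHom_sapa, sapTau_zero]

lemma sapFlipHom_comp_self (h1 : r * u - s * t = 1) :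
    (sapFlipHom h1).comp (sapFlipHom h1) = MonoidHom.id _ := by
  refine sapphire_hom_ext_sapTau (fun i j => ?_) ?_ ?_
  · simp [sapFlipHom, sapScalarHom_sapTau]
  · simp only [sapFlipHom, MonoidHom.comp_apply, sapScalarHom_sapTau, sapScalarHom_sapv,
      _root_.map_mul, ← mul_assoc, sapTau_mul, MonoidHom.id_apply]
    simp [sapTau_zero]
  · simp only [sapFlipHom, MonoidHom.comp_apply, sapScalarHom_sapTau, sapScalarHom_sapa,
      _root_.map_mul, ← mul_assoc, sapTau_mul, MonoidHom.id_apply]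
    simp [sapTau_zero]

lemma sapFlipHom_comp_sapTranslHom (h1 : r * u - s * t = 1) (c : ℤ × ℤ) :
    (sapFlipHom h1).comp (sapTranslHom h1 c) =
      (sapTranslHom h1 (-c)).comp (sapFlipHom h1) := by
  refine sapphire_hom_ext_sapTau (fun i j => ?_) ?_ ?_
  · simp only [sapFlipHom, sapTranslHom, MonoidHom.comp_apply, sapScalarHom_sapTau, one_mul]
  · simp only [sapFlipHom, sapTranslHom, MonoidHom.comp_apply, sapScalarHom_sapTau,
      sapScalarHom_sapv, _root_.map_mul, ← mul_assoc, sapTau_mul, Prod.fst_neg, Prod.snd_neg]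
    congr 2 <;> ring
  · simp only [sapFlipHom, sapTranslHom, MonoidHom.comp_apply, sapScalarHom_sapTau,
      sapScalarHom_sapa, _root_.map_mul, ← mul_assoc, sapTau_mul, Prod.snd_neg]
    congr 2
    ring

/-- The automorphisms of the sapphire group that fix `d` and `b` and preserve the cosets
`⟨d, b⟩ v` and `⟨d, b⟩ a`, parametrized by `ℤ × ℤ`. -/
def sapTransl (h1 : r * u - s * t = 1) : Multiplicative (ℤ × ℤ) →* MulAut (Sapphire r s t u) where
  toFun c := (sapTranslHom h1 c.toAdd).toMulEquiv (sapTranslHom h1 (-c.toAdd))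
    (by rw [sapTranslHom_comp, neg_add_cancel, sapTranslHom_zero])
    (by rw [sapTranslHom_comp, add_neg_cancel, sapTranslHom_zero])
  map_one' := MulEquiv.ext fun x => DFunLike.congr_fun (sapTranslHom_zero h1) x
  map_mul' c c' := MulEquiv.ext fun x =>
    (DFunLike.congr_fun (sapTranslHom_comp h1 c.toAdd c'.toAdd) x).symm

lemma sapTransl_apply (h1 : r * u - s * t = 1) (c : Multiplicative (ℤ × ℤ))
    (x : Sapphire r s t u) : sapTransl h1 c x = sapTranslHom h1 c.toAdd x := rfl

/-- The involutive automorphism of the sapphire group that inverts `d` and `b`. -/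
def sapFlip (h1 : r * u - s * t = 1) : MulAut (Sapphire r s t u) :=
  (sapFlipHom h1).toMulEquiv (sapFlipHom h1) (sapFlipHom_comp_self h1) (sapFlipHom_comp_self h1)

lemma sapFlip_apply (h1 : r * u - s * t = 1) (x : Sapphire r s t u) :
    sapFlip h1 x = sapFlipHom h1 x := rfl

lemma sapFlip_mul_self (h1 : r * u - s * t = 1) : sapFlip h1 * sapFlip h1 = 1 :=
  MulEquiv.ext fun x => DFunLike.congr_fun (sapFlipHom_comp_self h1) x

lemma sapFlip_mul_sapTransl (h1 : r * u - s * t = 1) (c : Multiplicative (ℤ × ℤ)) :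
    sapFlip h1 * sapTransl h1 c = sapTransl h1 c⁻¹ * sapFlip h1 :=
  MulEquiv.ext fun x => DFunLike.congr_fun (sapFlipHom_comp_sapTranslHom h1 c.toAdd) x

lemma sapDB_map_eq_of_scalar {φ : MulAut (Sapphire r s t u)} {ε : ℤ} (hε : ε * ε = 1)
    (hφ : ∀ i j, φ (τ i j) = τ (ε * i) (ε * j)) :
    (sapDB r s t u).map φ.toMonoidHom = sapDB r s t u := by
  refine le_antisymm ?_ fun x hx => ?_
  · rintro _ ⟨x, hx, rfl⟩
    obtain ⟨i, j, rfl⟩ := mem_sapDB_iff.1 hx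
    exact mem_sapDB_iff.2 ⟨_, _, hφ i j⟩
  · obtain ⟨i, j, rfl⟩ := mem_sapDB_iff.1 hx
    refine ⟨τ (ε * i) (ε * j), sapTau_mem _ _, (hφ _ _).trans ?_⟩
    rw [← mul_assoc, ← mul_assoc, hε, one_mul, one_mul]

lemma sapTransl_sapTau (h1 : r * u - s * t = 1) (c : Multiplicative (ℤ × ℤ)) (i j : ℤ) :
    sapTransl h1 c (τ i j) = τ i j := by
  rw [sapTransl_apply, sapTranslHom, sapScalarHom_sapTau, one_mul, one_mul]

lemma sapTransl_sapv (h1 : r * u - s * t = 1) (c : Multiplicative (ℤ × ℤ)) :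
    sapTransl h1 c 𝐯 = τ (t * c.toAdd.1) (c.toAdd.2 - u * c.toAdd.1) * 𝐯 := by
  rw [sapTransl_apply, sapTranslHom, sapScalarHom_sapv]

lemma sapTransl_sapa (h1 : r * u - s * t = 1) (c : Multiplicative (ℤ × ℤ)) :
    sapTransl h1 c 𝐚 = τ 0 c.toAdd.2 * 𝐚 := by
  rw [sapTransl_apply, sapTranslHom, sapScalarHom_sapa]

lemma sapFlip_sapTau (h1 : r * u - s * t = 1) (i j : ℤ) :
    sapFlip h1 (τ i j) = τ (-i) (-j) := by
  rw [sapFlip_apply, sapFlipHom, sapScalarHom_sapTau, neg_one_mul, neg_one_mul]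

lemma sapFlip_sapv (h1 : r * u - s * t = 1) : sapFlip h1 𝐯 = τ (1 - r) s * 𝐯 := by
  rw [sapFlip_apply, sapFlipHom, sapScalarHom_sapv]

lemma sapFlip_sapa (h1 : r * u - s * t = 1) : sapFlip h1 𝐚 = τ (-1) 0 * 𝐚 := by
  rw [sapFlip_apply, sapFlipHom, sapScalarHom_sapa]

lemma sapTransl_mem (h1 : r * u - s * t = 1) (c : Multiplicative (ℤ × ℤ)) :
    sapTransl h1 c ∈ sapAut₀₀ r s t u :=
  ⟨sapDB_map_eq_of_scalar (ε := 1) rfl fun i j => by rw [sapTransl_sapTau, one_mul, one_mul],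
    ⟨_, sapTau_mem _ _, sapTransl_sapv h1 c⟩, ⟨_, sapTau_mem _ _, sapTransl_sapa h1 c⟩⟩

lemma sapFlip_mem (h1 : r * u - s * t = 1) : sapFlip h1 ∈ sapAut₀₀ r s t u :=
  ⟨sapDB_map_eq_of_scalar (ε := -1) rfl fun i j => by
      rw [sapFlip_sapTau, neg_one_mul, neg_one_mul],
    ⟨_, sapTau_mem _ _, sapFlip_sapv h1⟩, ⟨_, sapTau_mem _ _, sapFlip_sapa h1⟩⟩

lemma sapTransl_injective (h1 : r * u - s * t = 1) : Function.Injective (sapTransl h1) := by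
  intro c c' h
  have hv := DFunLike.congr_fun h 𝐯
  have ha := DFunLike.congr_fun h 𝐚
  rw [sapTransl_sapv, sapTransl_sapv, mul_left_inj] at hv
  rw [sapTransl_sapa, sapTransl_sapa, mul_left_inj] at ha
  obtain ⟨hv₁, hv₂⟩ := sapTau_inj h1 hv
  obtain ⟨-, ha⟩ := sapTau_inj h1 ha
  have : c.toAdd.1 = c'.toAdd.1 := by
    linear_combination (-r) * hv₂ - s * hv₁ + r * ha - (c.toAdd.1 - c'.toAdd.1) * h1
  exact Prod.ext this ha

lemma exists_sapTransl_eq (h1 : r * u - s * t = 1) {φ : MulAut (Sapphire r s t u)}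
    (hφ : ∀ i j, φ (τ i j) = τ i j) {g₁ g₂ y : ℤ} (hv : φ 𝐯 = τ g₁ g₂ * 𝐯)
    (ha : φ 𝐚 = τ 0 y * 𝐚) : ∃ c, sapTransl h1 c = φ := by
  have h := congrArg φ (sapa_mul_sapv (r := r) (s := s) (t := t) (u := u))
  rw [_root_.map_mul, _root_.map_mul, _root_.map_mul, map_inv, hφ, hv, ha] at h
  have hv' (x : Sapphire r s t u) (i j : ℤ) : x * 𝐯⁻¹ * τ i j =
      x * τ ((r * u + s * t) * i + 2 * r * t * j) (2 * s * u * i + (r * u + s * t) * j) *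
        𝐯⁻¹ := by
    rw [mul_assoc, sapv_inv_mul_sapTau h1, ← mul_assoc]
  rw [mul_assoc, ← mul_assoc 𝐚, sapa_mul_sapTau, mul_assoc _ 𝐚, sapa_mul_sapv] at h
  simp only [_root_.mul_inv_rev, sapTau_inv, ← mul_assoc, sapTau_mul, hv', mul_left_inj] at h
  obtain ⟨e₁, e₂⟩ := sapTau_inj h1 h
  have key : u * g₁ + t * (g₂ - y) = 0 := by
    have a₁ : 2 * r * (u * g₁ + t * (g₂ - y)) = 0 := by linear_combination e₁ + g₁ * h1
    have a₂ : 2 * s * (u * g₁ + t * (g₂ - y)) = 0 := by linear_combination e₂ - (g₂ - y) * h1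
    have : 2 * (u * g₁ + t * (g₂ - y)) = 0 := by
      linear_combination u * a₁ - t * a₂ - 2 * (u * g₁ + t * (g₂ - y)) * h1
    linarith
  have hg₁ : t * (-r * (g₂ - y) - s * g₁) = g₁ := by
    linear_combination (-r) * key + g₁ * h1
  have hg₂ : y - u * (-r * (g₂ - y) - s * g₁) = g₂ := by
    linear_combination s * key + (g₂ - y) * h1
  refine ⟨ofAdd (-r * (g₂ - y) - s * g₁, y), ?_⟩
  have : (sapTransl h1 (ofAdd (-r * (g₂ - y) - s * g₁, y))).toMonoidHom = φ.toMonoidHom := by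
    refine sapphire_hom_ext_sapTau (fun i j => ?_) ?_ ?_
    · exact (sapTransl_sapTau h1 _ i j).trans (hφ i j).symm
    · refine (sapTransl_sapv h1 _).trans (Eq.trans ?_ hv.symm)
      rw [toAdd_ofAdd, hg₁, hg₂]
    · exact (sapTransl_sapa h1 _).trans ha.symm
  exact MulEquiv.ext fun x => DFunLike.congr_fun this x

lemma eq_sapTransl_or (h1 : r * u - s * t = 1) (h0 : r * s * t * u ≠ 0)
    {φ : MulAut (Sapphire r s t u)} (hφ : φ ∈ sapAut₀₀ r s t u) :
    ∃ c, φ = sapTransl h1 c ∨ φ = sapTransl h1 c * sapFlip h1 := by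
  obtain ⟨hDB, ⟨g, hg, hv⟩, k, hk, ha⟩ := hφ
  obtain ⟨g₁, g₂, rfl⟩ := mem_sapDB_iff.1 hg
  obtain ⟨k₁, k₂, rfl⟩ := mem_sapDB_iff.1 hk
  obtain ⟨a₁, a₂, hd⟩ := mem_sapDB_iff.1 (mem_of_map_eq hDB (sapTau_mem 1 0))
  obtain ⟨b₁, b₂, hb⟩ := mem_sapDB_iff.1 (mem_of_map_eq hDB (sapTau_mem 0 1))
  have hτ (i j : ℤ) : φ (τ i j) = τ (a₁ * i + b₁ * j) (a₂ * i + b₂ * j) := by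
    rw [sapTau, sapd_eq, sapb_eq, _root_.map_mul, map_zpow, map_zpow, hd, hb, sapTau_zpow,
      sapTau_zpow, sapTau_mul]
  have hsq := congrArg φ (sapa_sq (r := r) (s := s) (t := t) (u := u))
  rw [_root_.map_mul, ha, hd, mul_assoc, ← mul_assoc 𝐚, sapa_mul_sapTau, mul_assoc _ 𝐚, sapa_sq,
    sapTau_mul, sapTau_mul] at hsq
  obtain ⟨hk₁, ha₂⟩ := sapTau_inj h1 hsq
  have hab := congrArg φ (sapa_mul_sapTau (r := r) (s := s) (t := t) (u := u) 0 1)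
  rw [_root_.map_mul, _root_.map_mul, ha, hτ, hτ, mul_assoc, sapa_mul_sapTau, ← mul_assoc,
    ← mul_assoc, sapTau_mul, sapTau_mul, mul_left_inj] at hab
  obtain ⟨hb₁, -⟩ := sapTau_inj h1 hab
  have hvd := congrArg φ (sapv_mul_sapTau (r := r) (s := s) (t := t) (u := u) 1 0)
  rw [_root_.map_mul, _root_.map_mul, hv, hτ, hτ, mul_assoc, sapv_mul_sapTau, ← mul_assoc,
    ← mul_assoc, sapTau_mul, sapTau_mul, mul_left_inj] at hvd
  obtain ⟨-, hvd⟩ := sapTau_inj h1 hvd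
  have ha₂ : a₂ = 0 := by linarith
  have hb₁ : b₁ = 0 := by linarith
  subst ha₂ hb₁
  have hsu : 2 * s * u ≠ 0 := by
    refine fun h => h0 ?_
    have : s * u = 0 := by linarith
    linear_combination r * t * this
  obtain rfl : a₁ = b₂ := mul_left_cancel₀ hsu (by linear_combination -hvd)
  have hunit : IsUnit a₁ := by
    have hd' : τ 1 0 ∈ sapDB r s t u := sapTau_mem 1 0
    rw [← hDB] at hd'
    obtain ⟨x, hx, hx'⟩ := hd'
    obtain ⟨i, j, rfl⟩ := mem_sapDB_iff.1 hx
    have hx' : φ (τ i j) = τ 1 0 := hx'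
    rw [hτ] at hx'
    exact IsUnit.of_mul_eq_one i (by linarith [(sapTau_inj h1 hx').1])
  rcases Int.isUnit_iff.1 hunit with rfl | rfl
  · obtain rfl : k₁ = 0 := by linarith
    obtain ⟨c, hc⟩ := exists_sapTransl_eq h1 (φ := φ) (fun i j => by rw [hτ]; simp) hv ha
    exact ⟨c, .inl hc.symm⟩
  · obtain rfl : k₁ = -1 := by linarith
    obtain ⟨c, hc⟩ := exists_sapTransl_eq h1 (φ := φ * sapFlip h1)
      (g₁ := r - 1 + g₁) (g₂ := -s + g₂) (y := k₂)
      (fun i j => by rw [MulAut.mul_apply, sapFlip_sapTau, hτ]; simp)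
      (by
        rw [MulAut.mul_apply, sapFlip_sapv, _root_.map_mul, hτ, hv, ← mul_assoc, sapTau_mul]
        congr 2 <;> ring)
      (by
        rw [MulAut.mul_apply, sapFlip_sapa, _root_.map_mul, hτ, ha, ← mul_assoc, sapTau_mul]
        congr 2; ring)
    exact ⟨c, .inr (by rw [hc, mul_assoc, sapFlip_mul_self, mul_one])⟩

lemma sapTransl_ne_mul_sapFlip (h1 : r * u - s * t = 1) (c c' : Multiplicative (ℤ × ℤ)) :
    sapTransl h1 c ≠ sapTransl h1 c' * sapFlip h1 := by
  intro h
  have := DFunLike.congr_fun h (τ 1 0)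
  rw [MulAut.mul_apply, sapFlip_sapTau, sapTransl_sapTau, sapTransl_sapTau] at this
  have := (sapTau_inj h1 this).1
  omega

lemma sapToDihedral_apply_sapv {φ : MulAut (Sapphire r s t u)} (hφ : φ ∈ sapAut₀ r s t u) :
    sapToDihedral r s t u (φ 𝐯) = .r 1 := by
  obtain ⟨-, g, hg, hv⟩ := hφ
  obtain ⟨i, j, rfl⟩ := mem_sapDB_iff.1 hg
  rw [hv, _root_.map_mul, sapToDihedral_sapTau, sapToDihedral_sapv, one_mul]

lemma exists_apply_sapa_eq (h1 : r * u - s * t = 1) {φ : MulAut (Sapphire r s t u)}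
    (hφ : φ ∈ sapAut₀ r s t u) : ∃ i j n : ℤ, φ 𝐚 = τ i j * 𝐯 ^ n * 𝐚 := by
  obtain ⟨i, j, n, h | h⟩ := sapphire_normal_form h1 (φ 𝐚)
  · exfalso
    have hsq : sapToDihedral r s t u (φ 𝐚 * φ 𝐚) = 1 := by
      rw [← _root_.map_mul, sapa_sq, sapToDihedral_eq_one_iff h1]
      exact mem_of_map_eq hφ.1 (sapTau_mem 1 0)
    rw [_root_.map_mul, h, sapToDihedral_mul_zpow, DihedralGroup.r_mul_r,
      DihedralGroup.one_def, DihedralGroup.r.injEq] at hsq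
    have hn : n = 0 := by
      have : n + n = 0 := hsq
      omega
    subst hn
    have hmem : 𝐚 ∈ sapDB r s t u := by
      have := mem_of_map_eq (map_inv_eq_of_map_eq hφ.1) (g := φ 𝐚)
        (by rw [h, zpow_zero, mul_one]; exact sapTau_mem i j)
      rwa [MulAut.inv_apply_self] at this
    rw [← sapToDihedral_eq_one_iff h1, sapToDihedral_sapa, DihedralGroup.one_def] at hmem
    exact nomatch hmem
  · exact ⟨i, j, n, h⟩

/-- The exponent of the rotation part of an element of the infinite dihedral group. -/
def dihedralExponent : DihedralGroup 0 → ℤ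
  | .r i => i
  | .sr i => i

/-- The homomorphism sending `φ ∈ Aut₀(E)` with `φ a ∈ ⟨d, b⟩ * v ^ n * a` to `n`. -/
def sapShift (h1 : r * u - s * t = 1) : sapAut₀ r s t u →* Multiplicative ℤ :=
  MonoidHom.mk' (fun φ => ofAdd (-dihedralExponent (sapToDihedral r s t u (φ.1 𝐚)))) (by
    rintro ⟨φ, hφ⟩ ⟨χ, hχ⟩
    obtain ⟨i, j, n, h⟩ := exists_apply_sapa_eq h1 hφ
    obtain ⟨i', j', n', h'⟩ := exists_apply_sapa_eq h1 hχ
    have hτ : sapToDihedral r s t u (φ (τ i' j')) = 1 :=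
      (sapToDihedral_eq_one_iff h1).2 (mem_of_map_eq hφ.1 (sapTau_mem i' j'))
    have key : sapToDihedral r s t u (φ (χ 𝐚)) = .sr (-(n : ZMod 0) - (n' : ZMod 0)) := by
      rw [h', _root_.map_mul, _root_.map_mul, _root_.map_mul, _root_.map_mul, hτ, map_zpow,
        map_zpow, sapToDihedral_apply_sapv hφ, h, sapToDihedral_mul_zpow_mul, one_mul,
        DihedralGroup.r_one_zpow, DihedralGroup.r_mul_sr]
      rfl
    change ofAdd (-dihedralExponent (sapToDihedral r s t u (φ (χ 𝐚)))) =
      ofAdd (-dihedralExponent (sapToDihedral r s t u (φ 𝐚))) *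
        ofAdd (-dihedralExponent (sapToDihedral r s t u (χ 𝐚)))
    rw [key, h, h', sapToDihedral_mul_zpow_mul, sapToDihedral_mul_zpow_mul, ← ofAdd_add]
    change ofAdd (-(-n - n' : ℤ)) = ofAdd (- -n + - -n' : ℤ)
    congr 1
    ring)

lemma sapShift_of_apply_sapa_eq (h1 : r * u - s * t = 1) {φ : sapAut₀ r s t u} {i j n : ℤ}
    (h : φ.1 𝐚 = τ i j * 𝐯 ^ n * 𝐚) : sapShift h1 φ = ofAdd n := by
  change ofAdd (-dihedralExponent (sapToDihedral r s t u (φ.1 𝐚))) = _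
  rw [h, sapToDihedral_mul_zpow_mul]
  exact congrArg ofAdd (neg_neg n)

lemma sapShift_ker (h1 : r * u - s * t = 1) :
    (sapShift h1).ker = (sapAut₀₀ r s t u).subgroupOf (sapAut₀ r s t u) := by
  ext ⟨φ, hφ⟩
  rw [MonoidHom.mem_ker, Subgroup.mem_subgroupOf]
  constructor
  · intro h
    obtain ⟨i, j, n, hn⟩ := exists_apply_sapa_eq h1 hφ
    rw [sapShift_of_apply_sapa_eq h1 (φ := ⟨φ, hφ⟩) hn, ofAdd_eq_one] at h
    subst h
    exact ⟨hφ.1, hφ.2, τ i j, sapTau_mem i j, by rw [hn, zpow_zero, mul_one]⟩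
  · rintro ⟨-, -, g, hg, h⟩
    obtain ⟨i, j, rfl⟩ := mem_sapDB_iff.1 hg
    exact sapShift_of_apply_sapa_eq h1 (φ := ⟨φ, hφ⟩) (n := 0) (by rw [h, zpow_zero, mul_one])

lemma conj_sapv_mem (h1 : r * u - s * t = 1) : MulAut.conj 𝐯 ∈ sapAut₀ r s t u := by
  refine ⟨le_antisymm ?_ fun x hx => ?_, 1, one_mem _, by simp⟩
  · rintro _ ⟨x, hx, rfl⟩
    rw [SetLike.mem_coe, ← sapToDihedral_eq_one_iff h1] at hx
    change 𝐯 * x * 𝐯⁻¹ ∈ _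
    rw [← sapToDihedral_eq_one_iff h1, _root_.map_mul, _root_.map_mul, hx, map_inv]
    simp
  · refine ⟨𝐯⁻¹ * x * 𝐯, ?_, by simp [mul_assoc]⟩
    rw [SetLike.mem_coe]
    rw [← sapToDihedral_eq_one_iff h1] at hx ⊢
    rw [_root_.map_mul, _root_.map_mul, hx, map_inv]
    simp

lemma sapShift_ne_one (h1 : r * u - s * t = 1) :
    sapShift h1 ⟨MulAut.conj 𝐯, conj_sapv_mem h1⟩ ≠ 1 := by
  change ofAdd (-dihedralExponent (sapToDihedral r s t u (𝐯 * 𝐚 * 𝐯⁻¹))) ≠ 1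
  rw [_root_.map_mul, _root_.map_mul, map_inv, sapToDihedral_sapv, sapToDihedral_sapa]
  decide

end Sapphire

/-- The homomorphism from the group of order two determined by an element of square one. -/
def zmodTwoHom {G : Type*} [Group G] (x : G) (hx : x * x = 1) : Multiplicative (ZMod 2) →* G where
  toFun z := x ^ z.toAdd.val
  map_one' := by simp
  map_mul' z w := by
    rw [toAdd_mul, ZMod.val_add, ← pow_add]
    exact (pow_eq_pow_mod _ (by rw [sq, hx])).symm

lemma zmodTwoHom_ofAdd_one {G : Type*} [Group G] (x : G) (hx : x * x = 1) :
    zmodTwoHom x hx (ofAdd 1) = x := pow_one x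

lemma multiplicative_zmod_two_cases (z : Multiplicative (ZMod 2)) : z = 1 ∨ z = ofAdd 1 := by
  revert z; decide

/-- The action of `ℤ/2` on `ℤ × ℤ` by negation. -/
def negAction : Multiplicative (ZMod 2) →* MulAut (Multiplicative (ℤ × ℤ)) :=
  zmodTwoHom (MulEquiv.inv _) (MulEquiv.ext fun x => inv_inv x)

lemma negAction_ofAdd_one (x : Multiplicative (ℤ × ℤ)) : negAction (ofAdd 1) x = x⁻¹ := by
  rw [negAction, zmodTwoHom_ofAdd_one, MulEquiv.inv_apply]

/-- The homomorphism from `(ℤ × ℤ) ⋊ ℤ/2` to the automorphisms of the sapphire group. -/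
def sapSemidirectHom {r s t u : ℤ} (h1 : r * u - s * t = 1) :
    Multiplicative (ℤ × ℤ) ⋊[negAction] Multiplicative (ZMod 2) →*
      MulAut (Sapphire r s t u) :=
  SemidirectProduct.lift (sapTransl h1) (zmodTwoHom (sapFlip h1) (sapFlip_mul_self h1)) (by
    intro z
    rcases multiplicative_zmod_two_cases z with rfl | rfl
    · refine MonoidHom.ext fun c => ?_
      simp
    · refine MonoidHom.ext fun c => ?_
      rw [zmodTwoHom_ofAdd_one]
      change sapTransl h1 (negAction (ofAdd 1) c) = sapFlip h1 * sapTransl h1 c * (sapFlip h1)⁻¹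
      rw [negAction_ofAdd_one, sapFlip_mul_sapTransl, mul_inv_cancel_right])

lemma sapSemidirectHom_injective {r s t u : ℤ} (h1 : r * u - s * t = 1) :
    Function.Injective (sapSemidirectHom h1) := by
  rw [injective_iff_map_eq_one]
  rintro ⟨c, z⟩ h
  change sapTransl h1 c * zmodTwoHom _ _ z = 1 at h
  rcases multiplicative_zmod_two_cases z with rfl | rfl
  · rw [map_one, mul_one] at h
    obtain rfl : c = 1 := sapTransl_injective h1 (h.trans (map_one _).symm)
    rfl
  · rw [zmodTwoHom_ofAdd_one, ← map_one (sapTransl h1)] at h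
    exact absurd h.symm (sapTransl_ne_mul_sapFlip h1 1 c)

lemma sapSemidirectHom_range {r s t u : ℤ} (h1 : r * u - s * t = 1) (h0 : r * s * t * u ≠ 0) :
    (sapSemidirectHom h1).range = sapAut₀₀ r s t u := by
  refine le_antisymm ?_ fun φ hφ => ?_
  · rintro _ ⟨⟨c, z⟩, rfl⟩
    refine mul_mem (sapTransl_mem h1 c) ?_
    exact pow_mem (sapFlip_mem h1) _
  · obtain ⟨c, rfl | rfl⟩ := eq_sapTransl_or h1 h0 hφ
    · exact ⟨inl c, lift_inl ..⟩
    · refine ⟨⟨c, ofAdd 1⟩, ?_⟩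
      change sapTransl h1 c * zmodTwoHom _ _ (ofAdd 1) = _
      rw [zmodTwoHom_ofAdd_one]

/-- A nontrivial homomorphism to the infinite cyclic group can be replaced by a split surjection
with the same kernel. -/
lemma exists_split_surjective_of_ne_one {G : Type*} [Group G] (f : G →* Multiplicative ℤ)
    {x : G} (hx : f x ≠ 1) :
    ∃ π : G →* Multiplicative ℤ, Function.Surjective π ∧ π.ker = f.ker ∧
      ∃ σ : Multiplicative ℤ →* G, π.comp σ = MonoidHom.id _ := by
  have : Nontrivial f.range := ⟨⟨f x, x, rfl⟩, 1, fun h => hx (congrArg Subtype.val h)⟩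
  have : Infinite f.range := inferInstance
  let e : f.range ≃* Multiplicative ℤ :=
    mulEquivOfCyclicCardEq (by rw [Nat.card_eq_zero_of_infinite, Nat.card_eq_zero_of_infinite])
  let π : G →* Multiplicative ℤ := e.toMonoidHom.comp f.rangeRestrict
  have hπ : Function.Surjective π := e.surjective.comp f.rangeRestrict_surjective
  refine ⟨π, hπ, ?_, ?_⟩
  · rw [← f.ker_rangeRestrict]
    exact MonoidHom.ker_mulEquiv_comp f.rangeRestrict e
  · obtain ⟨g, hg⟩ := hπ (ofAdd 1)
    refine ⟨zpowersHom G g, MonoidHom.ext_mint ?_⟩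
    simp [hg]

/-- A split extension of `Q` with kernel isomorphic to `S` is a semidirect product. -/
lemma exists_mulEquiv_semidirectProduct {G S Q : Type*} [Group G] [Group S] [Group Q]
    (π : G →* Q) (σ : Q →* G) (h : π.comp σ = MonoidHom.id Q) (e : S ≃* π.ker) :
    ∃ ψ : Q →* MulAut S, Nonempty (G ≃* S ⋊[ψ] Q) := by
  let ψ : Q →* MulAut S :=
    (MulAut.congr e.symm).toMonoidHom.comp ((MulAut.conjNormal (H := π.ker)).comp σ)
  have hσ (x : Q) : π (σ x) = x := DFunLike.congr_fun h x
  have he (x : S) : π (e x) = 1 := (e x).2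
  let f : S ⋊[ψ] Q →* G := SemidirectProduct.lift (π.ker.subtype.comp e.toMonoidHom) σ (by
    intro q
    refine MonoidHom.ext fun x => ?_
    simp [ψ])
  have hf (x : S ⋊[ψ] Q) : f x = e x.left * σ x.right := rfl
  refine ⟨ψ, ⟨(MulEquiv.ofBijective f ⟨?_, fun g => ?_⟩).symm⟩⟩
  · rw [injective_iff_map_eq_one]
    intro x hx
    rw [hf] at hx
    have hr := congrArg π hx
    rw [_root_.map_mul, he, hσ, one_mul, map_one] at hr
    rw [hr, map_one, mul_one, OneMemClass.coe_eq_one, map_eq_one_iff e e.injective] at hx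
    exact SemidirectProduct.ext hx hr
  · have hg : g * (σ (π g))⁻¹ ∈ π.ker := by
      rw [MonoidHom.mem_ker, _root_.map_mul, map_inv, hσ, mul_inv_cancel]
    refine ⟨⟨e.symm ⟨_, hg⟩, π g⟩, ?_⟩
    rw [hf, MulEquiv.apply_symm_apply, inv_mul_cancel_right]

/-- There is a split short exact sequence
`1 → Aut₀⁰(E) → Aut₀(E) → ℤ → 1`; consequently
`Aut₀(E) ≅ ((ℤ × ℤ) ⋊ ℤ/2) ⋊ ℤ`, where the nontrivial element of `ℤ/2` acts on `ℤ × ℤ` by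
multiplication by `-1`. -/
theorem stmt14 (r s t u : ℤ) (h1 : r * u - s * t = 1) (h0 : r * s * t * u ≠ 0) :
    (∃ π : sapAut₀ r s t u →* Multiplicative ℤ,
      Function.Surjective π ∧
      π.ker = (sapAut₀₀ r s t u).subgroupOf (sapAut₀ r s t u) ∧
      ∃ σ : Multiplicative ℤ →* sapAut₀ r s t u,
        π.comp σ = MonoidHom.id (Multiplicative ℤ)) ∧
    ∃ ψ₂ : Multiplicative (ZMod 2) →* MulAut (Multiplicative (ℤ × ℤ)),
      (∀ x : Multiplicative (ℤ × ℤ), ψ₂ (Multiplicative.ofAdd 1) x = x⁻¹) ∧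
      ∃ ψ : Multiplicative ℤ →*
          MulAut (Multiplicative (ℤ × ℤ) ⋊[ψ₂] Multiplicative (ZMod 2)),
        Nonempty ((sapAut₀ r s t u) ≃*
          ((Multiplicative (ℤ × ℤ) ⋊[ψ₂] Multiplicative (ZMod 2)) ⋊[ψ]
            Multiplicative ℤ)) := by
  obtain ⟨π, hπ, hker, σ, hσ⟩ := exists_split_surjective_of_ne_one _ (sapShift_ne_one h1)
  rw [sapShift_ker h1] at hker
  have hle : sapAut₀₀ r s t u ≤ sapAut₀ r s t u := fun φ hφ => ⟨hφ.1, hφ.2.1⟩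
  refine ⟨⟨π, hπ, hker, σ, hσ⟩, negAction, negAction_ofAdd_one,
    exists_mulEquiv_semidirectProduct π σ hσ ?_⟩
  exact (MonoidHom.ofInjective (sapSemidirectHom_injective h1)).trans <|
    (MulEquiv.subgroupCongr (sapSemidirectHom_range h1 h0)).trans <|
    (Subgroup.subgroupOfEquivOfLe hle).symm.trans (MulEquiv.subgroupCongr hker.symm)
end
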